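/- Let F ⊆ [n] with |F| = f and let k ≤ n − f. Then the k-partner of F is the same as the k-partner of F ∖ F^t. -/

import Mathlib

open Finset

attribute [local instance] Classical.propDecidable

noncomputable section

/-- The ground set `[n] = {1, …, n}`. -/
def ground (n : ℕ) : Finset ℕ := Finset.Icc 1 n

/-- `C([n], k)`: the family of all `k`-element subsets of `[n]`. -/
def ksubsets (n k : ℕ) : Finset (Finset ℕ) := Finset.powersetCard k (ground n)

/-- Two families are cross intersecting. -/
def CrossInt (A B : Finset (Finset ℕ)) : Prop :=
  ∀ a ∈ A, ∀ b ∈ B, (a ∩ b).Nonempty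

/-- The lexicographic order `A ≺ B`:  `A ⊇ B` or `min (A ∖ B) < min (B ∖ A)`. -/
def lex (A B : Finset ℕ) : Prop :=
  B ⊆ A ∨ (A \ B).min < (B \ A).min

/-- Strict lexicographic order `A ⪵ B`. -/
def lexLT (A B : Finset ℕ) : Prop := lex A B ∧ A ≠ B

/-- `L(R, k)` over `[n]`: all `k`-subsets of `[n]` that are `≺ R`. -/
def Lset (n : ℕ) (R : Finset ℕ) (k : ℕ) : Finset (Finset ℕ) :=
  (ksubsets n k).filter fun F => lex F R

/-- `L(r, k)`: the first `r` elements of `C([n], k)` in lexicographic order. -/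
def Lnum (n r k : ℕ) : Finset (Finset ℕ) :=
  (ksubsets n k).filter fun F => ((ksubsets n k).filter fun G => lex G F).card ≤ r

/-- A family is L-initial if it equals `L(R, k)` for some `k`-set `R` (an ID of the family). -/
def LInitial (n k : ℕ) (A : Finset (Finset ℕ)) : Prop :=
  ∃ R ∈ ksubsets n k, A = Lset n R k

/-- `F` and `H` strongly intersect at their last element; `H` is the partner of `F`
(and `F` is the partner of `H`). -/
def IsPartner (F H : Finset ℕ) : Prop :=
  ∃ q, F ∩ H = {q} ∧ F ∪ H = Finset.Icc 1 q

/-- `K` is the `k`-partner of `F` (inside `[n]`). -/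
def IsKPartner (n k : ℕ) (F K : Finset ℕ) : Prop :=
  ∃ H, IsPartner F H ∧
    ((k = H.card ∧ K = H) ∨
     (H.card < k ∧ K = H ∪ Finset.Icc (n - k + H.card + 1) n) ∨
     (k < H.card ∧ K ∈ ksubsets n k ∧ lex K H ∧
        ∀ K' ∈ ksubsets n k, lex K' H → lex K' K))

/-- `ℓ(F)`: the largest `x` with `{n - x + 1, …, n} ⊆ F` (and `0` if there is none). -/
def ell (n : ℕ) (F : Finset ℕ) : ℕ :=
  ((Finset.range (n + 1)).filter fun x => Finset.Icc (n - x + 1) n ⊆ F).sup id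

/-- `F^t = {n - ℓ(F) + 1, …, n}` (which is `∅` when `ℓ(F) = 0`). -/
def tailPart (n : ℕ) (F : Finset ℕ) : Finset ℕ := Finset.Icc (n - ell n F + 1) n

/-- Maximal cross intersecting families. -/
def MaximalCross (n f g : ℕ) (F G : Finset (Finset ℕ)) : Prop :=
  F ⊆ ksubsets n f ∧ G ⊆ ksubsets n g ∧ CrossInt F G ∧
    ∀ F' G' : Finset (Finset ℕ), F ⊆ F' → F' ⊆ ksubsets n f →
      G ⊆ G' → G' ⊆ ksubsets n g → CrossInt F' G' → F = F' ∧ G = G'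

/-- The pair of sets `(F, G)` is maximal. -/
def PairMaximal (n : ℕ) (F G : Finset ℕ) : Prop :=
  MaximalCross n F.card G.card (Lset n F F.card) (Lset n G G.card)

/-- Maximal pair families. -/
def MaximalPairFamilies (n : ℕ) (A1 A2 : Finset (Finset ℕ)) : Prop :=
  A1.card = A2.card ∧ ∀ a1 ∈ A1, ∃! a2, a2 ∈ A2 ∧ PairMaximal n a1 a2

/-- `H1` is the `|H1|`-parity of `H2` (intended for `|H1| ≤ |H2|`):
`H1 ∖ H1^t = H2 ∖ H2^t` and `ℓ(H2) - ℓ(H1) = |H2| - |H1|`. -/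
def IsParity (n : ℕ) (H1 H2 : Finset ℕ) : Prop :=
  H1 \ tailPart n H1 = H2 \ tailPart n H2 ∧
    ell n H2 + H1.card = ell n H1 + H2.card

/-- The family `H1` of `h1`-sets is the `h1`-parity of the family `H2` of `h2`-sets. -/
def FamParity (n h1 h2 : ℕ) (H1 H2 : Finset (Finset ℕ)) : Prop :=
  (∀ A ∈ H1, ∃ B ∈ ksubsets n h2, IsParity n A B ∧ B ∈ H2) ∧
  (∀ B ∈ H2, ∀ A ∈ ksubsets n h1, IsParity n A B → A ∈ H1)

/-- An `(n, k 0, …, k (t-1))`-cross intersecting system:  non-empty pairwise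
cross intersecting families `F i ⊆ C([n], k i)`. -/
def IsCIS (n : ℕ) {t : ℕ} (k : Fin t → ℕ) (F : Fin t → Finset (Finset ℕ)) : Prop :=
  (∀ i, F i ⊆ ksubsets n (k i)) ∧ (∀ i, (F i).Nonempty) ∧
    ∀ i j : Fin t, i < j → CrossInt (F i) (F j)

/-- An extremal cross intersecting system. -/
def Extremal (n : ℕ) {t : ℕ} (k : Fin t → ℕ) (F : Fin t → Finset (Finset ℕ)) : Prop :=
  IsCIS n k F ∧ ∀ G : Fin t → Finset (Finset ℕ), IsCIS n k G →
    ∑ i, (G i).card ≤ ∑ i, (F i).card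

/-- Two systems of families are isomorphic via a permutation of the ground set `[n]`. -/
def IsoSystems (n : ℕ) {t : ℕ} (F G : Fin t → Finset (Finset ℕ)) : Prop :=
  ∃ σ : Equiv.Perm ℕ, (∀ x ∈ ground n, σ x ∈ ground n) ∧
    ∀ i, F i = (G i).image fun s => s.image ⇑σ

/-- The family `ℛ₂`. -/
def R2fam (n k2 kt : ℕ) : Finset (Finset ℕ) :=
  (ksubsets n k2).filter fun R =>
    lex (insert 1 (Finset.Icc (n - k2 + 2) n)) R ∧
    lex R (insert kt (Finset.Icc (n - k2 + 2) n))

/-- The family `ℱ₂,₃`. -/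
def F23 (n k2 k3 kt : ℕ) : Finset (Finset ℕ) :=
  (R2fam n k2 kt).filter fun A => ∃ B ∈ ksubsets n k3, PairMaximal n A B

/-- `K` is the last `k`-subset of `[n]` that is `≺ H`. -/
def IsLastBelow (n k : ℕ) (H K : Finset ℕ) : Prop :=
  K ∈ ksubsets n k ∧ lex K H ∧ ∀ K' ∈ ksubsets n k, lex K' H → lex K' K

theorem mem_ksubsets {n k : ℕ} {K : Finset ℕ} :
    K ∈ ksubsets n k ↔ K ⊆ Finset.Icc 1 n ∧ K.card = k :=
  Finset.mem_powersetCard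

theorem lex_iff {A B : Finset ℕ} :
    lex A B ↔ B ⊆ A ∨ ∃ x ∈ A, x ∉ B ∧ ∀ y ∈ B, y ∉ A → x < y := by
  unfold lex
  refine or_congr_right ⟨fun h => ?_, ?_⟩
  · obtain ⟨x, hx⟩ := Finset.min_of_nonempty
      (Finset.nonempty_iff_ne_empty.2 fun h0 : A \ B = ∅ => by simp [h0] at h)
    have hxm := Finset.mem_of_min hx
    rw [Finset.mem_sdiff] at hxm
    refine ⟨x, hxm.1, hxm.2, fun y hy hyA => ?_⟩
    have hmin := Finset.min_le (Finset.mem_sdiff.2 ⟨hy, hyA⟩)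
    rw [hx] at h
    exact WithTop.coe_lt_coe.1 (h.trans_le hmin)
  · rintro ⟨x, hxA, hxB, h⟩
    refine (Finset.min_le (Finset.mem_sdiff.2 ⟨hxA, hxB⟩)).trans_lt ?_
    rcases (B \ A).eq_empty_or_nonempty with h0 | h0
    · rw [h0, Finset.min_empty]
      exact WithTop.coe_lt_top x
    · obtain ⟨y, hy⟩ := Finset.min_of_nonempty h0
      have hym := Finset.mem_of_min hy
      rw [Finset.mem_sdiff] at hym
      rw [hy]
      exact WithTop.coe_lt_coe.2 (h y hym.1 hym.2)

theorem lex_antisymm {A B : Finset ℕ} (h₁ : lex A B) (h₂ : lex B A) : A = B := by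
  rw [lex_iff] at h₁ h₂
  rcases h₁ with h₁ | ⟨x, hxA, hxB, hx⟩ <;> rcases h₂ with h₂ | ⟨y, hyB, hyA, hy⟩
  · exact h₂.antisymm h₁
  · exact absurd (h₁ hyB) hyA
  · exact absurd (h₂ hxA) hxB
  · exact absurd (hx y hyB hyA) (hy x hxA hxB).not_gt

theorem IsLastBelow.unique {n k : ℕ} {H K₁ K₂ : Finset ℕ} (h₁ : IsLastBelow n k H K₁)
    (h₂ : IsLastBelow n k H K₂) : K₁ = K₂ :=
  lex_antisymm (h₂.2.2 _ h₁.1 h₁.2.1) (h₁.2.2 _ h₂.1 h₂.2.1)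

theorem isLastBelow_union_Icc {n k q : ℕ} {H : Finset ℕ} (hH : H ⊆ Finset.Icc 1 q)
    (hHk : H.card ≤ k) (hkn : k ≤ n) (hqk : q + k ≤ n + H.card) :
    IsLastBelow n k H (H ∪ Finset.Icc (n - k + H.card + 1) n) := by
  have hHq : ∀ y ∈ H, 1 ≤ y ∧ y ≤ q := fun y hy => Finset.mem_Icc.1 (hH hy)
  have hcard : (H ∪ Finset.Icc (n - k + H.card + 1) n).card = k := by
    rw [Finset.card_union_of_disjoint, Nat.card_Icc]
    · omega
    · rw [Finset.disjoint_left]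
      intro y hy hy'
      have := hHq y hy
      rw [Finset.mem_Icc] at hy'
      omega
  refine ⟨mem_ksubsets.2 ⟨fun y hy => ?_, hcard⟩, Or.inl Finset.subset_union_left, ?_⟩
  · rw [Finset.mem_union, Finset.mem_Icc] at hy
    rw [Finset.mem_Icc]
    rcases hy with hy | hy
    · have := hHq y hy
      omega
    · omega
  · intro K' hK' hlex
    rw [mem_ksubsets] at hK'
    rw [lex_iff] at hlex ⊢
    by_cases hsub : H ⊆ K'
    · by_cases heq : K' ⊆ H ∪ Finset.Icc (n - k + H.card + 1) n
      · exact Or.inl (Finset.eq_of_subset_of_card_le heq (by omega)).ge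
      · obtain ⟨x, hx, hx'⟩ := Finset.not_subset.1 heq
        refine Or.inr ⟨x, hx, hx', fun y hy hy' => ?_⟩
        have hxn := Finset.mem_Icc.1 (hK'.1 hx)
        simp only [Finset.mem_union, Finset.mem_Icc, not_or] at hx' hy
        have := hy.resolve_left fun h => hy' (hsub h)
        omega
    · obtain ⟨z, hz, hz'⟩ := Finset.not_subset.1 hsub
      obtain ⟨x, hx, hxH, hxy⟩ := hlex.resolve_left hsub
      have hxz := hxy z hz hz'
      have hzq := hHq z hz
      refine Or.inr ⟨x, hx, ?_, fun y hy hy' => ?_⟩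
      · simp only [Finset.mem_union, Finset.mem_Icc, not_or]
        exact ⟨hxH, by omega⟩
      · rw [Finset.mem_union, Finset.mem_Icc] at hy
        rcases hy with hy | hy
        · exact hxy y hy hy'
        · omega

theorem isPartner_iff {F H : Finset ℕ} {q : ℕ} (hq : q ∈ F) (hF : F ⊆ Finset.Icc 1 q) :
    IsPartner F H ↔ H = insert q (Finset.Icc 1 q \ F) := by
  have hF' : ∀ y ∈ F, 1 ≤ y ∧ y ≤ q := fun y hy => Finset.mem_Icc.1 (hF hy)
  constructor
  · rintro ⟨p, hinter, hunion⟩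
    rw [Finset.ext_iff] at hinter hunion
    simp only [Finset.mem_inter, Finset.mem_singleton, Finset.mem_union, Finset.mem_Icc]
      at hinter hunion
    have hp := (hinter p).2 rfl
    have hpq : p = q := by
      have := (hunion q).1 (Or.inl hq)
      have := hF' p hp.1
      omega
    subst hpq
    ext y
    simp only [Finset.mem_insert, Finset.mem_sdiff, Finset.mem_Icc]
    grind
  · rintro rfl
    refine ⟨q, ?_, ?_⟩ <;> ext y <;>
      simp only [Finset.mem_inter, Finset.mem_union, Finset.mem_singleton, Finset.mem_insert,
        Finset.mem_sdiff, Finset.mem_Icc] <;> grind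

theorem card_partner {F : Finset ℕ} {q : ℕ} (hq : q ∈ F) (hF : F ⊆ Finset.Icc 1 q) :
    (insert q (Finset.Icc 1 q \ F)).card = q - F.card + 1 := by
  rw [Finset.card_insert_of_notMem (by simp [hq]), Finset.card_sdiff_of_subset hF, Nat.card_Icc]
  rfl

theorem isKPartner_iff_isLastBelow {n k q : ℕ} {F K : Finset ℕ} (hq : q ∈ F)
    (hF : F ⊆ Finset.Icc 1 q) (hkn : k ≤ n)
    (hk : q + k ≤ n + (insert q (Finset.Icc 1 q \ F)).card) :
    IsKPartner n k F K ↔ IsLastBelow n k (insert q (Finset.Icc 1 q \ F)) K := by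
  simp only [IsKPartner, isPartner_iff hq hF, exists_eq_left]
  have hH : insert q (Finset.Icc 1 q \ F) ⊆ Finset.Icc 1 q :=
    Finset.insert_subset (hF hq) Finset.sdiff_subset
  generalize insert q (Finset.Icc 1 q \ F) = H at hk hH ⊢
  rcases lt_or_ge k H.card with hlt | hge
  · constructor
    · rintro (⟨h, -⟩ | ⟨h, -⟩ | ⟨-, h⟩)
      · omega
      · omega
      · exact h
    · exact fun h => Or.inr (Or.inr ⟨hlt, h⟩)
  · have hlast := isLastBelow_union_Icc hH hge hkn hk
    have hiff : IsLastBelow n k H K ↔ K = H ∪ Finset.Icc (n - k + H.card + 1) n :=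
      ⟨fun h => h.unique hlast, fun h => h ▸ hlast⟩
    rw [hiff]
    rcases hge.eq_or_lt with heq | hgt
    · have hempty : Finset.Icc (n - k + H.card + 1) n = ∅ := Finset.Icc_eq_empty (by omega)
      rw [hempty, Finset.union_empty]
      simp [heq]
    · simp [hgt, hgt.ne', hgt.not_gt]

/-- A set is `≺` the partner of `G` iff it meets `G` before missing a non-element of `G`. -/
theorem lex_partner_iff {G K : Finset ℕ} {m n : ℕ} (hm : m ∈ G) (hG : G ⊆ Finset.Icc 1 m)
    (hK : K ⊆ Finset.Icc 1 n) :
    lex K (insert m (Finset.Icc 1 m \ G)) ↔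
      ∃ x ∈ K, x ∈ G ∧ ∀ y ∈ Finset.Icc 1 m \ G, y ∉ K → x < y := by
  have hGm : ∀ y ∈ G, 1 ≤ y ∧ y ≤ m := fun y hy => Finset.mem_Icc.1 (hG hy)
  rw [lex_iff]
  constructor
  · intro h
    by_cases hsub : insert m (Finset.Icc 1 m \ G) ⊆ K
    · exact ⟨m, hsub (Finset.mem_insert_self _ _), hm,
        fun y hy hyK => absurd (hsub (Finset.mem_insert_of_mem hy)) hyK⟩
    · obtain ⟨x, hx, hxH, hxy⟩ := h.resolve_left hsub
      obtain ⟨z, hz, hzK⟩ := Finset.not_subset.1 hsub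
      have hxz := hxy z hz hzK
      have hx1 := Finset.mem_Icc.1 (hK hx)
      refine ⟨x, hx, ?_, fun y hy => hxy y (Finset.mem_insert_of_mem hy)⟩
      simp only [Finset.mem_insert, Finset.mem_sdiff, Finset.mem_Icc] at hz hxH
      grind
  · rintro ⟨x, hx, hxG, hxy⟩
    simp only [Finset.mem_sdiff, Finset.mem_Icc] at hxy
    have hxm := hGm x hxG
    by_cases hxeq : x = m
    · left
      intro y hy
      simp only [Finset.mem_insert, Finset.mem_sdiff, Finset.mem_Icc] at hy
      grind
    · right
      refine ⟨x, hx, ?_, fun y hy hyK => ?_⟩ <;>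
        simp only [Finset.mem_insert, Finset.mem_sdiff, Finset.mem_Icc] at * <;> grind

/-- If `F` contains the final segment `(a, n]`, a small set that is `≺` the partner of `F`
already meets `F` before that segment. -/
theorem lex_partner_iff_of_Icc_subset {F K : Finset ℕ} {a n : ℕ} (hn : n ∈ F)
    (hF : F ⊆ Finset.Icc 1 n) (ha : Finset.Icc (a + 1) n ⊆ F)
    (hK : K ⊆ Finset.Icc 1 n) (hcard : K.card ≤ n - F.card) :
    lex K (insert n (Finset.Icc 1 n \ F)) ↔
      ∃ x ∈ K, x ∈ F \ Finset.Icc (a + 1) n ∧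
        ∀ y ∈ Finset.Icc 1 n \ F, y ∉ K → x < y := by
  rw [lex_partner_iff hn hF hK]
  constructor
  · rintro ⟨x, hx, hxF, hxy⟩
    refine ⟨x, hx, Finset.mem_sdiff.2 ⟨hxF, fun hxa => ?_⟩, hxy⟩
    have hsub : insert x (Finset.Icc 1 n \ F) ⊆ K := by
      refine Finset.insert_subset hx fun y hy => ?_
      by_contra hyK
      have hlt := hxy y hy hyK
      simp only [Finset.mem_sdiff, Finset.mem_Icc] at hy hxa
      exact hy.2 (ha (Finset.mem_Icc.2 ⟨by omega, by omega⟩))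
    have hle := Finset.card_le_card hsub
    rw [Finset.card_insert_of_notMem (by simp [hxF]), Finset.card_sdiff_of_subset hF,
      Nat.card_Icc] at hle
    omega
  · rintro ⟨x, hx, hxF, hxy⟩
    exact ⟨x, hx, (Finset.mem_sdiff.1 hxF).1, hxy⟩

theorem tailPart_subset (n : ℕ) (F : Finset ℕ) : tailPart n F ⊆ F := by
  have hne : ((Finset.range (n + 1)).filter fun x => Finset.Icc (n - x + 1) n ⊆ F).Nonempty :=
    ⟨0, by simp⟩
  obtain ⟨x, hx, hsup⟩ := Finset.exists_mem_eq_sup _ hne id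
  rw [tailPart, ell, hsup]
  exact (Finset.mem_filter.1 hx).2

theorem not_isKPartner_empty {n k : ℕ} {K : Finset ℕ} : ¬ IsKPartner n k ∅ K := by
  rintro ⟨H, ⟨q, hq, -⟩, -⟩
  rw [Finset.empty_inter] at hq
  exact (Finset.singleton_ne_empty q hq.symm).elim

theorem isKPartner_sdiff_Icc {n k a : ℕ} {F K : Finset ℕ} (hF : F ⊆ Finset.Icc 1 n)
    (hk : k ≤ n - F.card) (ha : Finset.Icc (a + 1) n ⊆ F) :
    IsKPartner n k F K ↔ IsKPartner n k (F \ Finset.Icc (a + 1) n) K := by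
  rcases le_or_gt n a with hna | han
  · rw [Finset.Icc_eq_empty (by omega), Finset.sdiff_empty]
  have hn : n ∈ F := ha (Finset.mem_Icc.2 ⟨han, le_rfl⟩)
  have hlexF : ∀ K' ∈ ksubsets n k, (lex K' (insert n (Finset.Icc 1 n \ F)) ↔ _) :=
    fun K' hK' => lex_partner_iff_of_Icc_subset hn hF ha (mem_ksubsets.1 hK').1
      ((mem_ksubsets.1 hK').2.trans_le hk)
  have hfn : F.card ≤ n := by simpa using Finset.card_le_card hF
  rw [isKPartner_iff_isLastBelow hn hF (by omega) (by rw [card_partner hn hF]; omega)]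
  rcases (F \ Finset.Icc (a + 1) n).eq_empty_or_nonempty with hG | hG
  · rw [hG]
    refine iff_of_false (fun h => ?_) not_isKPartner_empty
    obtain ⟨x, -, hx, -⟩ := (hlexF K h.1).1 h.2.1
    simp [hG] at hx
  have hcardG := Finset.card_sdiff_add_card_eq_card ha
  generalize hGdef : F \ Finset.Icc (a + 1) n = G at *
  have hGF : ∀ y, y ∈ G ↔ y ∈ F ∧ ¬ (a + 1 ≤ y ∧ y ≤ n) := by
    intro y
    rw [← hGdef, Finset.mem_sdiff, Finset.mem_Icc]
  obtain ⟨m, hm, hmax⟩ : ∃ m ∈ G, ∀ y ∈ G, y ≤ m := ⟨G.max' hG, G.max'_mem hG, G.le_max'⟩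
  have hFn : ∀ y ∈ F, 1 ≤ y ∧ y ≤ n := fun y hy => Finset.mem_Icc.1 (hF hy)
  have hGm : G ⊆ Finset.Icc 1 m := fun y hy =>
    Finset.mem_Icc.2 ⟨(hFn y ((hGF y).1 hy).1).1, hmax y hy⟩
  have hmn := hFn m ((hGF m).1 hm).1
  have hma : m ≤ a := by
    have := ((hGF m).1 hm).2
    omega
  have hGcard : G.card ≤ m := by simpa using Finset.card_le_card hGm
  have hGcard' : G.card ≤ F.card := by omega
  rw [isKPartner_iff_isLastBelow hm hGm (by omega) (by rw [card_partner hm hGm]; omega)]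
  have hlex : ∀ K' ∈ ksubsets n k, (lex K' (insert n (Finset.Icc 1 n \ F)) ↔
      lex K' (insert m (Finset.Icc 1 m \ G))) := by
    intro K' hK'
    rw [hlexF K' hK', lex_partner_iff hm hGm (mem_ksubsets.1 hK').1]
    refine exists_congr fun x => and_congr_right fun _ => and_congr_right fun hxG => ?_
    have hxm := hmax x hxG
    simp only [Finset.mem_sdiff, Finset.mem_Icc, hGF]
    constructor
    · intro h y hy
      exact h y ⟨by omega, fun hyF => hy.2 ⟨hyF, by omega⟩⟩
    · intro h y hy hyK
      by_cases hym : y ≤ m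
      · exact h y ⟨by omega, fun hyF => hy.2 hyF.1⟩ hyK
      · omega
  refine and_congr_right fun hK => and_congr (hlex K hK) ?_
  exact forall₂_congr fun K' hK' => by rw [hlex K' hK']

/-- the `k`-partner of `F` coincides with the `k`-partner of `F ∖ F^t`. -/
theorem kpartner_tail (n f k : ℕ) (F : Finset ℕ) (hF : F ⊆ ground n)
    (hcard : F.card = f) (hk : k ≤ n - f) :
    ∀ K : Finset ℕ, IsKPartner n k F K ↔ IsKPartner n k (F \ tailPart n F) K := by
  intro K
  subst hcard
  exact isKPartner_sdiff_Icc hF hk (tailPart_subset n F)
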